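/- arXiv:math/9905049 — 2 statements merged into one kernel-verified Lean document; each statement's English description precedes it below -/
import Mathlib

section
/- The affine quadric cone Y = Spec C[x,y,z]/(xy − z²) has trivial Picard group, and more strongly, every finitely generated projective module over the ring C[x,y,z]/(xy − z²) is free. -/
open MvPolynomial

/-- The coordinate ring `ℂ[x,y,z]/(xy - z²)` of the affine quadric cone. -/
noncomputable abbrev QuadricConeRing : Type :=
  MvPolynomial (Fin 3) ℂ ⧸
    Ideal.span {(X 0 * X 1 - X 2 ^ 2 : MvPolynomial (Fin 3) ℂ)}


namespace Polynomial.Parity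

/-- The involution of `ℂ[u][v]` sending `u` to `-u` and `v` to `-v`. -/
noncomputable def negVars : ℂ[X][X] →+* ℂ[X][X] :=
  (compRingHom (-X)).comp (mapRingHom (compRingHom (-X)))

lemma negVars_C_C (z : ℂ) : negVars (C (C z)) = C (C z) := by
  simp [negVars]

lemma negVars_C (c : ℂ[X]) : negVars (C c) = C (c.comp (-X)) := by
  simp [negVars]

lemma negVars_X : negVars X = -X := by
  simp [negVars]

lemma negVars_negVars (b : ℂ[X][X]) : negVars (negVars b) = b := by
  have h : negVars.comp negVars = RingHom.id _ := by
    ext <;> simp [negVars]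
  exact DFunLike.congr_fun h b

lemma negVars_monomial (k : ℕ) (c : ℂ[X]) :
    negVars (monomial k c) = monomial k ((-1) ^ k * c.comp (-X)) := by
  rw [← C_mul_X_pow_eq_monomial, map_mul, map_pow, negVars_X, negVars_C, neg_pow,
    ← C_mul_X_pow_eq_monomial]
  simp
  ring

lemma coeff_negVars (b : ℂ[X][X]) (k : ℕ) :
    (negVars b).coeff k = (-1) ^ k * (b.coeff k).comp (-X) := by
  induction b using Polynomial.induction_on' with
  | add p q hp hq => simp [hp, hq, mul_add]
  | monomial n a =>
    rw [negVars_monomial, coeff_monomial, coeff_monomial]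
    split_ifs with h
    · rw [h]
    · simp

lemma natDegree_negVars_le (b : ℂ[X][X]) : (negVars b).natDegree ≤ b.natDegree := by
  refine natDegree_le_iff_coeff_eq_zero.2 fun k hk => ?_
  rw [coeff_negVars, coeff_eq_zero_of_natDegree_lt hk]
  simp

/-- `b` is homogeneous of parity `s` for the `ℤ/2`-grading in which `u` and `v` are odd. -/
def HasParity (s : ℤˣ) (b : ℂ[X][X]) : Prop := negVars b = ((s : ℤ) : ℂ[X][X]) * b

lemma unit_mul_self (s : ℤˣ) : ((s : ℤ) : ℂ[X][X]) * ((s : ℤ) : ℂ[X][X]) = 1 := by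
  rw [← Int.cast_mul, ← Units.val_mul, Int.units_mul_self]
  simp

namespace HasParity

variable {s t : ℤˣ} {a b : ℂ[X][X]}

lemma one : HasParity 1 1 := by simp [HasParity]

lemma add (ha : HasParity s a) (hb : HasParity s b) : HasParity s (a + b) := by
  unfold HasParity at *
  rw [map_add, ha, hb, mul_add]

lemma neg (ha : HasParity s a) : HasParity s (-a) := by
  unfold HasParity at *
  rw [map_neg, ha]
  ring

lemma sub (ha : HasParity s a) (hb : HasParity s b) : HasParity s (a - b) := by
  rw [sub_eq_add_neg]
  exact ha.add hb.neg

lemma mul (ha : HasParity s a) (hb : HasParity t b) : HasParity (s * t) (a * b) := by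
  unfold HasParity at *
  rw [map_mul, ha, hb]
  push_cast
  ring

lemma pow (ha : HasParity s a) (n : ℕ) : HasParity (s ^ n) (a ^ n) := by
  induction n with
  | zero => simpa using one
  | succ n ih => rw [pow_succ, pow_succ]; exact ih.mul ha

lemma X : HasParity (-1) X := by
  rw [HasParity, negVars_X]
  push_cast
  ring

lemma of_mul_left (ha : HasParity s a) (ha0 : a ≠ 0) (h : HasParity t (a * b)) :
    HasParity (s * t) b := by
  unfold HasParity at *
  rw [map_mul, ha] at h
  apply mul_left_cancel₀ ha0
  have := unit_mul_self s
  push_cast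
  linear_combination ((s : ℤ) : ℂ[X][X]) * h - a * negVars b * this

lemma monomial_coeff (hb : HasParity s b) (k : ℕ) :
    HasParity s (monomial k (b.coeff k)) := by
  unfold HasParity at *
  rw [negVars_monomial, ← coeff_negVars, hb, ← C_eq_intCast, coeff_C_mul, C_mul_monomial]

lemma C_coeff (hb : HasParity s b) (k : ℕ) :
    HasParity ((-1) ^ k * s) (C (b.coeff k)) := by
  have h := hb.monomial_coeff k
  rw [← C_mul_X_pow_eq_monomial, mul_comm] at h
  exact (HasParity.X.pow k).of_mul_left (pow_ne_zero _ X_ne_zero) h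

end HasParity

/-- The homogeneous component of parity `s`. -/
noncomputable def component (s : ℤˣ) : ℂ[X][X] →+ ℂ[X][X] where
  toFun b := C (C 2⁻¹) * (b + ((s : ℤ) : ℂ[X][X]) * negVars b)
  map_zero' := by simp
  map_add' a b := by rw [map_add]; ring

lemma component_apply (s : ℤˣ) (b : ℂ[X][X]) :
    component s b = C (C 2⁻¹) * (b + ((s : ℤ) : ℂ[X][X]) * negVars b) := rfl

lemma half_mul_two : (C (C 2⁻¹) : ℂ[X][X]) * 2 = 1 := by
  rw [show (2 : ℂ[X][X]) = C (C 2) by rw [map_ofNat, map_ofNat], ← C_mul, ← C_mul,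
    inv_mul_cancel₀ two_ne_zero, C_1, C_1]

lemma hasParity_component (s : ℤˣ) (b : ℂ[X][X]) : HasParity s (component s b) := by
  unfold HasParity
  rw [component_apply, map_mul, negVars_C_C, map_add, map_mul, negVars_negVars, map_intCast]
  linear_combination - C (C 2⁻¹) * negVars b * unit_mul_self s

lemma component_add_component_neg (s : ℤˣ) (b : ℂ[X][X]) :
    component s b + component (-s) b = b := by
  rw [component_apply, component_apply]
  push_cast
  linear_combination b * half_mul_two

lemma HasParity.component_mul {s t : ℤˣ} {c : ℂ[X][X]} (hc : HasParity t c) (b : ℂ[X][X]) :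
    component s (b * c) = component (s * t) b * c := by
  unfold HasParity at hc
  rw [component_apply, component_apply, map_mul, hc]
  push_cast
  ring

lemma HasParity.component_eq {s : ℤˣ} {b : ℂ[X][X]} (hb : HasParity s b) :
    component s b = b := by
  unfold HasParity at hb
  rw [component_apply, hb]
  linear_combination b * half_mul_two + C (C 2⁻¹) * b * unit_mul_self s

lemma component_C (s : ℤˣ) (d : ℂ[X]) :
    component s (C d) = C (C 2⁻¹ * (d + ((s : ℤ) : ℂ[X]) * d.comp (-X))) := by
  rw [component_apply, negVars_C]
  simp

lemma natDegree_component_le (s : ℤˣ) (b : ℂ[X][X]) :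
    (component s b).natDegree ≤ b.natDegree := by
  rw [component_apply, ← C_eq_intCast]
  refine (natDegree_C_mul_le _ _).trans (natDegree_add_le_of_degree_le le_rfl ?_)
  exact (natDegree_C_mul_le _ _).trans (natDegree_negVars_le b)

/-- A vector all of whose coordinates are homogeneous of parity `s`. -/
def VecParity {m : ℕ} (s : ℤˣ) (w : Fin m → ℂ[X][X]) : Prop := ∀ k, HasParity s (w k)

/-- The homogeneous component of parity `s` of a vector. -/
noncomputable def vecComponent {m : ℕ} (s : ℤˣ) (w : Fin m → ℂ[X][X]) : Fin m → ℂ[X][X] :=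
  fun k => component s (w k)

variable {m n : ℕ}

lemma VecParity.smul {s t : ℤˣ} {b : ℂ[X][X]} {w : Fin m → ℂ[X][X]} (hb : HasParity s b)
    (hw : VecParity t w) : VecParity (s * t) (b • w) :=
  fun k => hb.mul (hw k)

lemma VecParity.vecComponent_smul {s t : ℤˣ} {w : Fin m → ℂ[X][X]} (hw : VecParity t w)
    (b : ℂ[X][X]) : vecComponent s (b • w) = component (s * t) b • w :=
  _root_.funext fun k => (hw k).component_mul b

lemma vecComponent_sub (s : ℤˣ) (v w : Fin m → ℂ[X][X]) :
    vecComponent s (v - w) = vecComponent s v - vecComponent s w :=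
  _root_.funext fun _ => map_sub _ _ _

lemma vecComponent_sum {s : ℤˣ} {σ : Fin n → ℤˣ} {f : Fin n → Fin m → ℂ[X][X]}
    (hf : ∀ i, VecParity (σ i) (f i)) (a : Fin n → ℂ[X][X]) :
    vecComponent s (∑ i, a i • f i) = ∑ i, component (s * σ i) (a i) • f i := by
  ext1 k
  simp only [vecComponent, Finset.sum_apply, map_sum, Pi.smul_apply, smul_eq_mul]
  exact Finset.sum_congr rfl fun i _ => (hf i k).component_mul _

lemma vecComponent_add_vecComponent_neg (s : ℤˣ) (w : Fin m → ℂ[X][X]) :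
    vecComponent s w + vecComponent (-s) w = w :=
  _root_.funext fun k => component_add_component_neg s (w k)

lemma VecParity.vecComponent_eq {s : ℤˣ} {w : Fin m → ℂ[X][X]} (hw : VecParity s w) :
    vecComponent s w = w :=
  _root_.funext fun k => (hw k).component_eq

lemma vecParity_vecComponent (s : ℤˣ) (w : Fin m → ℂ[X][X]) :
    VecParity s (vecComponent s w) :=
  fun k => hasParity_component s (w k)

/-- The coefficients expressing a homogeneous vector in an independent family of homogeneous
vectors are homogeneous. -/
lemma hasParity_of_sum {s : ℤˣ} {σ : Fin n → ℤˣ} {f : Fin n → Fin m → ℂ[X][X]}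
    (hf : ∀ i, VecParity (σ i) (f i)) (hli : LinearIndependent ℂ[X][X] f)
    {a : Fin n → ℂ[X][X]} (ha : VecParity s (∑ i, a i • f i)) (i : Fin n) :
    HasParity (s * σ i) (a i) := by
  have h := ha.vecComponent_eq
  rw [vecComponent_sum hf, ← sub_eq_zero, ← Finset.sum_sub_distrib] at h
  have h2 := Fintype.linearIndependent_iff.1 hli
    (fun j => component (s * σ j) (a j) - a j)
    ((Finset.sum_congr rfl fun j _ => sub_smul _ _ _).trans h) i
  rw [← sub_eq_zero.1 h2]
  exact hasParity_component _ _

lemma vecComponent_mem_span {s : ℤˣ} {σ : Fin n → ℤˣ} {f : Fin n → Fin m → ℂ[X][X]}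
    (hf : ∀ i, VecParity (σ i) (f i)) {w : Fin m → ℂ[X][X]}
    (hw : w ∈ Submodule.span ℂ[X][X] (Set.range f)) :
    vecComponent s w ∈ Submodule.span ℂ[X][X] (Set.range f) := by
  obtain ⟨a, rfl⟩ := (Submodule.mem_span_range_iff_exists_fun _).1 hw
  rw [vecComponent_sum hf]
  exact (Submodule.mem_span_range_iff_exists_fun _).2 ⟨_, rfl⟩

/-- The determinant of a family of vectors with respect to a linear map to a free module. -/
noncomputable def famDet {R : Type*} [CommRing R] {m n : ℕ} (g : (Fin m → R) →ₗ[R] (Fin n → R))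
    (f : Fin n → Fin m → R) : R :=
  (Matrix.of fun i => g (f i)).det

/-- An independent family over a domain is mapped to a nondegenerate one by some linear map. -/
lemma exists_linearMap_det_ne_zero {R : Type*} [CommRing R] [IsDomain R] {m n : ℕ}
    {f : Fin n → Fin m → R} (hf : LinearIndependent R f) :
    ∃ g : (Fin m → R) →ₗ[R] (Fin n → R), famDet g f ≠ 0 := by
  classical
  let K := FractionRing R
  let ι : (Fin m → R) →ₗ[R] (Fin m → K) := (Algebra.linearMap R K).compLeft (Fin m)
  have hι : Function.Injective ι := fun v w h => _root_.funext fun k =>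
    IsFractionRing.injective R K (congrFun h k)
  have hK : LinearIndependent K (ι ∘ f) :=
    (LinearIndependent.iff_fractionRing R K).1 (hf.map' ι (LinearMap.ker_eq_bot.2 hι))
  obtain ⟨h, hh⟩ := LinearMap.exists_leftInverse_of_injective (Fintype.linearCombination K (ι ∘ f))
    (LinearMap.ker_eq_bot.2 (linearIndependent_iff_injective_fintypeLinearCombination.1 hK))
  obtain ⟨d, hd⟩ := IsLocalization.exist_integer_multiples_of_finite (nonZeroDivisors R)
    (fun ij : Fin m × Fin n => h (Pi.single ij.1 1) ij.2)
  choose G hG using hd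
  refine ⟨Fintype.linearCombination R fun k j => G (k, j), ?_⟩
  have key : (Matrix.of fun i => Fintype.linearCombination R (fun k j => G (k, j)) (f i)) =
      (d : R) • (1 : Matrix (Fin n) (Fin n) R) := by
    ext i j
    apply IsFractionRing.injective R K
    have h1 := congrFun (LinearMap.congr_fun hh (Pi.single i 1)) j
    have h2 : (ι (f i)) = ∑ k, algebraMap R K (f i k) • (Pi.single k 1 : Fin m → K) := by
      ext k
      simp [ι, Finset.sum_apply, Pi.single_apply, Algebra.smul_def]
    simp only [LinearMap.comp_apply, LinearMap.id_apply, Fintype.linearCombination_apply_single,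
      one_smul, Function.comp_apply, h2, map_sum, map_smul, Finset.sum_apply, Pi.smul_apply,
      smul_eq_mul] at h1
    simp only [Matrix.of_apply, Fintype.linearCombination_apply, Finset.sum_apply, Pi.smul_apply,
      smul_eq_mul, map_sum, map_mul, hG, Matrix.smul_apply, Matrix.one_apply]
    rw [show (if i = j then (1 : R) else 0) = if j = i then 1 else 0 by simp only [eq_comm],
      apply_ite (algebraMap R K), map_one, map_zero, ← Pi.single_apply i (1 : K) j, ← h1,
      Finset.mul_sum]
    refine Finset.sum_congr rfl fun k _ => ?_
    rw [Algebra.smul_def]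
    ring
  rw [famDet, key, Matrix.det_smul, Matrix.det_one, mul_one]
  exact pow_ne_zero _ (nonZeroDivisors.ne_zero d.2)

lemma famDet_update {R : Type*} [CommRing R] {m n : ℕ} (g : (Fin m → R) →ₗ[R] (Fin n → R))
    (f : Fin n → Fin m → R) {b : R} {r : Fin n → R} {e : Fin m → R}
    (h : b • e = ∑ j, r j • f j) (i : Fin n) :
    b * famDet g (Function.update f i e) = r i * famDet g f := by
  have h1 : (Matrix.of fun j => g (Function.update f i e j)) =
      (Matrix.of fun j => g (f j)).updateRow i (g e) := by
    ext j k
    by_cases hj : j = i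
    · subst hj; simp
    · simp [hj]
  have h2 : b • g e = ∑ j, r j • (Matrix.of fun j => g (f j)) j := by
    rw [← map_smul, h, map_sum]
    simp only [map_smul]
    rfl
  rw [famDet, h1, ← Matrix.det_updateRow_smul, h2, Matrix.det_updateRow_sum, smul_eq_mul, famDet]

lemma linearIndependent_of_famDet_ne_zero {R : Type*} [CommRing R] [IsDomain R] {m n : ℕ}
    {g : (Fin m → R) →ₗ[R] (Fin n → R)} {f : Fin n → Fin m → R} (h : famDet g f ≠ 0) :
    LinearIndependent R f :=
  LinearIndependent.of_comp g (Matrix.linearIndependent_rows_of_det_ne_zero h)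

/-- The lexicographic degree of a bivariate polynomial. -/
noncomputable def lexDegree (b : ℂ[X][X]) : ℕ ×ₗ ℕ :=
  toLex (b.natDegree, b.leadingCoeff.natDegree)

lemma lexDegree_lt_of_mul_eq {a b c d : ℂ[X][X]} (h : b * c = a * d) (ha : a ≠ 0) (hd : d ≠ 0)
    (hab : a.natDegree < b.natDegree) : lexDegree c < lexDegree d := by
  have hbc : b * c ≠ 0 := h ▸ mul_ne_zero ha hd
  have h1 := congrArg natDegree h
  rw [natDegree_mul (left_ne_zero_of_mul hbc) (right_ne_zero_of_mul hbc), natDegree_mul ha hd] at h1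
  exact Prod.Lex.toLex_lt_toLex.2 (Or.inl (by dsimp only; omega))

lemma lexDegree_lt_of_C_mul_eq {p : ℂ[X]} {c d : ℂ[X][X]} (h : C p * c = d) (hd : d ≠ 0)
    (hp : p.natDegree ≠ 0) : lexDegree c < lexDegree d := by
  subst h
  have hp0 : p ≠ 0 := by rintro rfl; simp at hp
  have hc : c ≠ 0 := right_ne_zero_of_mul hd
  refine Prod.Lex.toLex_lt_toLex.2 (Or.inr ⟨(natDegree_C_mul hp0).symm, ?_⟩)
  dsimp only
  rw [leadingCoeff_mul, leadingCoeff_C, natDegree_mul hp0 (leadingCoeff_ne_zero.2 hc)]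
  omega

/-- Pseudo-division by `b`, simultaneously for finitely many polynomials. -/
lemma exists_pseudo_div {R : Type*} [CommRing R] [IsDomain R] {b : R[X]} (hb : b ≠ 0) {n : ℕ}
    (a : Fin n → R[X]) :
    ∃ (k : ℕ) (q r : Fin n → R[X]),
      ∀ i, C (b.leadingCoeff ^ k) * a i = b * q i + r i ∧ (r i).degree < b.degree := by
  have single : ∀ (N : ℕ) (a : R[X]), a.degree < N →
      ∃ (k : ℕ) (q r : R[X]), C (b.leadingCoeff ^ k) * a = b * q + r ∧ r.degree < b.degree := by
    intro N
    induction N with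
    | zero =>
      intro a ha
      refine ⟨0, 0, a, by simp, ?_⟩
      have : a = 0 := degree_eq_bot.1 (by simpa using ha)
      rw [this, degree_zero]
      exact bot_lt_iff_ne_bot.2 (degree_ne_bot.2 hb)
    | succ N ih =>
      intro a ha
      by_cases hab : a.degree < b.degree
      · exact ⟨0, 0, a, by simp, hab⟩
      · have ha0 : a ≠ 0 := by
          rintro rfl
          exact hab (by rw [degree_zero]; exact bot_lt_iff_ne_bot.2 (degree_ne_bot.2 hb))
        have hle : b.natDegree ≤ a.natDegree :=
          natDegree_le_natDegree (not_lt.1 hab)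
        have hN : a.natDegree ≤ N := by
          rw [degree_eq_natDegree ha0] at ha
          exact Nat.lt_succ_iff.1 (by exact_mod_cast ha)
        obtain ⟨k, q, r, h1, h2⟩ := ih (C b.leadingCoeff * a -
            b * monomial (a.natDegree - b.natDegree) a.leadingCoeff) (by
          rw [degree_lt_iff_coeff_zero]
          intro j hj
          have e1 : b * monomial (a.natDegree - b.natDegree) a.leadingCoeff =
              C a.leadingCoeff * (b * X ^ (a.natDegree - b.natDegree)) := by
            rw [← C_mul_X_pow_eq_monomial]
            ring
          rw [e1, coeff_sub, coeff_C_mul, coeff_C_mul, coeff_mul_X_pow',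
            if_pos (by omega)]
          rcases (show a.natDegree ≤ j by omega).eq_or_lt with h | h
          · rw [← h, Nat.sub_sub_self hle, coeff_natDegree, coeff_natDegree]
            ring
          · rw [coeff_eq_zero_of_natDegree_lt h, coeff_eq_zero_of_natDegree_lt (by omega)]
            simp)
        refine ⟨k + 1, q + C (b.leadingCoeff ^ k) *
          monomial (a.natDegree - b.natDegree) a.leadingCoeff, r, ?_, h2⟩
        rw [pow_succ, C_mul]
        linear_combination h1
  have hN : ∀ i, (a i).degree < ((a i).natDegree + 1 : ℕ) := fun i =>
    lt_of_le_of_lt degree_le_natDegree (by exact_mod_cast Nat.lt_succ_self _)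
  choose k q r h using fun i => single _ (a i) (hN i)
  have hb' : b.leadingCoeff ≠ 0 := leadingCoeff_ne_zero.2 hb
  refine ⟨∑ i, k i, fun i => C (b.leadingCoeff ^ (∑ j ∈ Finset.univ.erase i, k j)) * q i,
    fun i => C (b.leadingCoeff ^ (∑ j ∈ Finset.univ.erase i, k j)) * r i, fun i => ⟨?_, ?_⟩⟩
  · rw [← Finset.sum_erase_add _ _ (Finset.mem_univ i), pow_add, C_mul]
    linear_combination C (b.leadingCoeff ^ (∑ j ∈ Finset.univ.erase i, k j)) * (h i).1
  · rw [degree_C_mul (pow_ne_zero _ hb')]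
    exact (h i).2

/-- If the leading coefficient of `a` is coprime to `p`, then `a` is regular modulo `p`. -/
lemma C_dvd_of_C_dvd_mul {R : Type*} [CommRing R] [IsDomain R] {p : R} {a : R[X]}
    (h : IsCoprime a.leadingCoeff p) :
    ∀ (N : ℕ) (x : R[X]), x.degree < N → C p ∣ a * x → C p ∣ x := by
  intro N
  induction N with
  | zero =>
    intro x hx _
    rw [degree_eq_bot.1 (by simpa using hx : x.degree = ⊥)]
    exact dvd_zero _
  | succ N ih =>
    intro x hx hd
    by_cases hx0 : x = 0
    · rw [hx0]; exact dvd_zero _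
    have h1 : p ∣ a.leadingCoeff * x.leadingCoeff := by
      rw [← leadingCoeff_mul]
      exact C_dvd_iff_dvd_coeff _ _ |>.1 hd _
    obtain ⟨t, ht⟩ := h.symm.dvd_of_dvd_mul_left h1
    have h2 : C p ∣ monomial x.natDegree x.leadingCoeff :=
      ⟨monomial x.natDegree t, by rw [C_mul_monomial, ht]⟩
    rw [← eraseLead_add_monomial_natDegree_leadingCoeff x]
    refine dvd_add (ih _ ?_ ?_) h2
    · have h3 := degree_eraseLead_lt hx0
      rw [degree_eq_natDegree hx0] at h3 hx
      refine h3.trans_le ?_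
      exact_mod_cast Nat.lt_succ_iff.1 (by exact_mod_cast hx)
    · rw [← eraseLead_add_monomial_natDegree_leadingCoeff x, mul_add] at hd
      exact (dvd_add_left (h2.mul_left a)).1 hd

/-- A family of homogeneous elements of a submodule. -/
structure HomFamily (E : Submodule ℂ[X][X] (Fin m → ℂ[X][X])) (f : Fin n → Fin m → ℂ[X][X])
    (s : Fin n → ℤˣ) : Prop where
  mem : ∀ i, f i ∈ E
  parity : ∀ i, VecParity (s i) (f i)

lemma HomFamily.update {E : Submodule ℂ[X][X] (Fin m → ℂ[X][X])} {f : Fin n → Fin m → ℂ[X][X]}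
    {s : Fin n → ℤˣ} (hf : HomFamily E f s) (i : Fin n) {e : Fin m → ℂ[X][X]} {t : ℤˣ}
    (he : e ∈ E) (ht : VecParity t e) :
    HomFamily E (Function.update f i e) (Function.update s i t) := by
  constructor <;> intro j <;> by_cases hj : j = i
  · subst hj; simpa using he
  · simpa [hj] using hf.mem j
  · subst hj; simpa using ht
  · simpa [hj] using hf.parity j

lemma exists_maximal_homFamily (E : Submodule ℂ[X][X] (Fin m → ℂ[X][X])) :
    ∃ n : ℕ, (∃ (f : Fin n → Fin m → ℂ[X][X]) (s : Fin n → ℤˣ), HomFamily E f s ∧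
      LinearIndependent ℂ[X][X] f) ∧
      ∀ (f : Fin n → Fin m → ℂ[X][X]) (s : Fin n → ℤˣ), HomFamily E f s →
        LinearIndependent ℂ[X][X] f → ∀ e ∈ E, ∀ t, VecParity t e →
          ∃ b : ℂ[X][X], b ≠ 0 ∧ b • e ∈ Submodule.span ℂ[X][X] (Set.range f) := by
  classical
  let P : ℕ → Prop := fun n => ∃ (f : Fin n → Fin m → ℂ[X][X]) (s : Fin n → ℤˣ),
    HomFamily E f s ∧ LinearIndependent ℂ[X][X] f
  have hP0 : P 0 := ⟨Fin.elim0, Fin.elim0, ⟨fun i => i.elim0, fun i => i.elim0⟩,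
    linearIndependent_empty_type⟩
  have hbound : ∀ n, P n → n ≤ m := by
    rintro n ⟨f, s, -, hli⟩
    simpa using hli.fintype_card_le_finrank
  refine ⟨Nat.findGreatest P m, Nat.findGreatest_spec (P := P) (Nat.zero_le m) hP0,
    fun f s hf hli e he t ht => ?_⟩
  have hnot : ¬ LinearIndependent ℂ[X][X] (Fin.cons e f : Fin _ → Fin m → ℂ[X][X]) := by
    intro h
    have hP : P (Nat.findGreatest P m + 1) := by
      refine ⟨Fin.cons e f, Fin.cons t s, ⟨?_, ?_⟩, h⟩
      · exact Fin.cases (by simpa using he) fun i => by simpa using hf.mem i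
      · exact Fin.cases (by simpa using ht) fun i => by simpa using hf.parity i
    have := Nat.le_findGreatest (hbound _ hP) hP
    omega
  obtain ⟨c, hc, i, hi⟩ := Fintype.not_linearIndependent_iff.1 hnot
  rw [Fin.sum_univ_succ] at hc
  simp only [Fin.cons_zero, Fin.cons_succ] at hc
  refine ⟨c 0, ?_, ?_⟩
  · intro h0
    rw [h0, zero_smul, zero_add] at hc
    have h1 := Fintype.linearIndependent_iff.1 hli (fun i => c i.succ) hc
    exact hi (Fin.cases h0 h1 i)
  · rw [eq_neg_of_add_eq_zero_left hc]
    exact neg_mem (sum_mem fun j _ => Submodule.smul_mem _ _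
      (Submodule.subset_span (Set.mem_range_self j)))

lemma component_ne_zero_or {b : ℂ[X][X]} (hb : b ≠ 0) : ∃ s, component s b ≠ 0 := by
  by_contra! h
  apply hb
  rw [← component_add_component_neg 1 b, h, h, add_zero]

section Minimal

variable {E : Submodule ℂ[X][X] (Fin m → ℂ[X][X])}
  {g : (Fin m → ℂ[X][X]) →ₗ[ℂ[X][X]] (Fin n → ℂ[X][X])} {μ : ℕ ×ₗ ℕ}

/-- For a family of minimal lexicographic degree, the quotient of `E` by its span is torsion over
`ℂ[u]`. -/
lemma exists_C_smul_mem
    (hmin : ∀ f s, HomFamily E f s → famDet g f ≠ 0 → ¬ lexDegree (famDet g f) < μ)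
    {f : Fin n → Fin m → ℂ[X][X]} {s : Fin n → ℤˣ} (hf : HomFamily E f s)
    (hdet : famDet g f ≠ 0) (hμ : lexDegree (famDet g f) = μ)
    {e : Fin m → ℂ[X][X]} (he : e ∈ E) {t : ℤˣ} (ht : VecParity t e) {b : ℂ[X][X]} (hb : b ≠ 0)
    (hbe : b • e ∈ Submodule.span ℂ[X][X] (Set.range f)) :
    ∃ (c : ℂ[X]), c ≠ 0 ∧ C c • e ∈ Submodule.span ℂ[X][X] (Set.range f) := by
  have hli := linearIndependent_of_famDet_ne_zero hdet
  obtain ⟨τ, hτ⟩ := component_ne_zero_or hb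
  wlog hbτ : HasParity τ b generalizing b
  · refine this (b := component τ b) hτ ?_ ?_ (hasParity_component _ _)
    · have := vecComponent_mem_span (s := τ * t) hf.parity hbe
      rwa [ht.vecComponent_smul, mul_assoc, Int.units_mul_self, mul_one] at this
    · rwa [(hasParity_component τ b).component_eq]
  obtain ⟨a, ha⟩ := (Submodule.mem_span_range_iff_exists_fun _).1 hbe
  obtain ⟨k, q, r, hqr⟩ := exists_pseudo_div hb a
  set c := b.leadingCoeff ^ k with hc
  have hc0 : c ≠ 0 := pow_ne_zero _ (leadingCoeff_ne_zero.2 hb)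
  have hcpar : HasParity (((-1) ^ b.natDegree * τ) ^ k) (C c) := by
    rw [hc, C_pow]
    exact (hbτ.C_coeff b.natDegree).pow k
  set κ := ((-1) ^ b.natDegree * τ) ^ k
  set e₁ := C c • e - ∑ i, q i • f i with he₁
  have hbe₁ : b • e₁ = ∑ i, r i • f i := by
    rw [he₁, smul_sub, smul_comm, ← ha, Finset.smul_sum, Finset.smul_sum,
      ← Finset.sum_sub_distrib]
    refine Finset.sum_congr rfl fun i _ => ?_
    rw [smul_smul, smul_smul, (hqr i).1, add_smul, add_sub_cancel_left]
  set e₂ := vecComponent (κ * t) e₁ with he₂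
  have hbe₂ : b • e₂ = ∑ i, component (κ * t * τ * s i) (r i) • f i := by
    have h1 : b • e₂ = vecComponent (κ * t * τ) (b • e₁) := by
      ext1 k
      simp only [he₂, vecComponent, Pi.smul_apply, smul_eq_mul]
      rw [mul_comm, mul_comm b, hbτ.component_mul, mul_assoc (κ * t), Int.units_mul_self, mul_one]
    rw [h1, hbe₁, vecComponent_sum hf.parity]
  have he₂' : e₂ = C c • e - ∑ i, component (κ * t * s i) (q i) • f i := by
    rw [he₂, he₁, vecComponent_sub, vecComponent_sum hf.parity, ht.vecComponent_smul, mul_assoc κ,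
      Int.units_mul_self, mul_one, hcpar.component_eq]
  have hsum : ∀ a : Fin n → ℂ[X][X], ∑ i, a i • f i ∈ Submodule.span ℂ[X][X] (Set.range f) :=
    fun a => (Submodule.mem_span_range_iff_exists_fun _).2 ⟨a, rfl⟩
  have hFE : Submodule.span ℂ[X][X] (Set.range f) ≤ E :=
    Submodule.span_le.2 (Set.range_subset_iff.2 hf.mem)
  have he₂E : e₂ ∈ E := by
    rw [he₂']
    exact sub_mem (E.smul_mem _ he) (hFE (hsum _))
  have hr : ∀ i, component (κ * t * τ * s i) (r i) = 0 := by
    intro i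
    by_contra hri
    have hdeg : (component (κ * t * τ * s i) (r i)).natDegree < b.natDegree := by
      refine (natDegree_component_le _ _).trans_lt (natDegree_lt_natDegree ?_ (hqr i).2)
      rintro h0
      rw [h0, map_zero] at hri
      exact hri rfl
    have hD := famDet_update g f hbe₂ i
    have hD0 : famDet g (Function.update f i e₂) ≠ 0 := by
      intro h0
      rw [h0, mul_zero] at hD
      exact mul_ne_zero hri hdet hD.symm
    exact hmin _ _ (hf.update i he₂E (vecParity_vecComponent _ _)) hD0
      (hμ ▸ lexDegree_lt_of_mul_eq hD hri hdet hdeg)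
  have he₂0 : e₂ = 0 := by
    simp only [hr, zero_smul, Finset.sum_const_zero] at hbe₂
    exact (smul_eq_zero.1 hbe₂).resolve_left hb
  refine ⟨c, hc0, ?_⟩
  rw [he₂0, eq_comm, sub_eq_zero] at he₂'
  rw [he₂']
  exact hsum _

lemma famDet_update_add (f : Fin n → Fin m → ℂ[X][X]) {i j : Fin n} (hij : i ≠ j)
    (q : ℂ[X][X]) : famDet g (Function.update f j (f j + q • f i)) = famDet g f := by
  have h := famDet_update g f (b := 1) (r := Pi.single j 1 + Pi.single i q)
    (e := f j + q • f i) (by simp [add_smul, Finset.sum_add_distrib, Pi.single_apply, ite_smul]) j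
  simpa [hij.symm] using h

lemma span_update_add {R M : Type*} [Ring R] [AddCommGroup M] [Module R M] (f : Fin n → M)
    {i j : Fin n} (hij : i ≠ j) (q : R) :
    Submodule.span R (Set.range (Function.update f j (f j + q • f i))) =
      Submodule.span R (Set.range f) := by
  have hmem : ∀ (h : Fin n → M) k, h k ∈ Submodule.span R (Set.range h) := fun h k =>
    Submodule.subset_span (Set.mem_range_self k)
  apply le_antisymm <;> rw [Submodule.span_le, Set.range_subset_iff] <;> intro k <;>
    by_cases hk : k = j
  · subst hk
    simpa using add_mem (hmem f k) (Submodule.smul_mem _ q (hmem f i))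
  · simpa [hk] using hmem f k
  · subst hk
    have h1 := hmem (Function.update f k (f k + q • f i)) k
    have h2 := hmem (Function.update f k (f k + q • f i)) i
    rw [Function.update_self] at h1
    rw [Function.update_of_ne hij] at h2
    simpa using sub_mem h1 (Submodule.smul_mem _ q h2)
  · simpa [hk] using hmem (Function.update f j (f j + q • f i)) k

/-- A degree function that distinguishes `0` from the nonzero constants. -/
noncomputable def weight (a : ℂ[X][X]) : ℕ := by
  classical exact if a = 0 then 0 else a.natDegree + 1

lemma weight_lt {a b : ℂ[X][X]} (h : a.degree < b.degree) : weight a < weight b := by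
  have hb : b ≠ 0 := ne_zero_of_degree_gt h
  unfold weight
  rw [if_neg hb]
  split_ifs with ha
  · omega
  · have := natDegree_lt_natDegree ha h
    omega

lemma sum_weight_update_lt (a : Fin n → ℂ[X][X]) {i : Fin n} {x : ℂ[X][X]}
    (h : x.degree < (a i).degree) :
    ∑ l, weight (Function.update a i x l) < ∑ l, weight (a l) := by
  refine Finset.sum_lt_sum (fun l _ => ?_) ⟨i, Finset.mem_univ i, by simpa using weight_lt h⟩
  by_cases hl : l = i
  · subst hl
    simpa using (weight_lt h).le
  · simp [hl]

/-- Adding a multiple of `f i` to `e` changes only one coefficient of a relation. -/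
lemma relation_update {R M : Type*} [CommRing R] [AddCommGroup M] [Module R M] {f : Fin n → M}
    {a : Fin n → R} {e : M} {p y z : R} (hrel : p • e = ∑ l, a l • f l) (i : Fin n)
    (h : a i - p * y = z) :
    p • (e - y • f i) = ∑ l, Function.update a i z l • f l := by
  have h1 : ∑ l, Function.update a i z l • f l - ∑ l, a l • f l = (z - a i) • f i := by
    rw [← Finset.sum_sub_distrib, Finset.sum_eq_single i]
    · rw [Function.update_self, sub_smul]
    · intro l _ hl
      rw [Function.update_of_ne hl, sub_self]
    · simp
  rw [eq_add_of_sub_eq h1, ← hrel, ← h, smul_sub, smul_smul, sub_sub_cancel_left,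
    neg_smul]
  abel

lemma relation_update_family {R M : Type*} [CommRing R] [AddCommGroup M] [Module R M]
    {f : Fin n → M} {a : Fin n → R} {i j : Fin n} (hij : i ≠ j) (q : R) :
    ∑ l, a l • f l = ∑ l, Function.update a i (a i - q * a j) l •
      Function.update f j (f j + q • f i) l := by
  rw [← sub_eq_zero, ← Finset.sum_sub_distrib, Finset.sum_eq_add i j hij]
  · rw [Function.update_self, Function.update_of_ne hij, Function.update_of_ne hij.symm,
      Function.update_self, sub_smul, smul_add, smul_smul, mul_comm q]
    abel
  · rintro l _ ⟨hi, hj⟩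
    rw [Function.update_of_ne hi, Function.update_of_ne hj, sub_self]
  · simp
  · simp

/-- For a family of minimal lexicographic degree there is no homogeneous `e` outside its span with
`p • e` in the span, when `p` is a homogeneous generator of the annihilators of such elements. -/
lemma no_relation
    (hsat : ∀ b : ℂ[X][X], b ≠ 0 → ∀ w, b • w ∈ E → w ∈ E)
    (hmin : ∀ f s, HomFamily E f s → famDet g f ≠ 0 → ¬ lexDegree (famDet g f) < μ)
    {F : Submodule ℂ[X][X] (Fin m → ℂ[X][X])} {p : ℂ[X]} {τ : ℤˣ} (hp0 : p ≠ 0)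
    (hp1 : p.natDegree ≠ 0) (hpτ : HasParity τ (C p))
    (hann : ∀ e t, VecParity t e → e ∈ E → e ∉ F → C p • e ∈ F → ∀ d : ℂ[X], C d • e ∈ F → p ∣ d)
    (N : ℕ) : ∀ (f : Fin n → Fin m → ℂ[X][X]) (s : Fin n → ℤˣ) (e : Fin m → ℂ[X][X]) (t : ℤˣ)
      (a : Fin n → ℂ[X][X]), HomFamily E f s → Submodule.span ℂ[X][X] (Set.range f) = F →
      famDet g f ≠ 0 → lexDegree (famDet g f) = μ → e ∈ E → VecParity t e → e ∉ F →
      C p • e = ∑ i, a i • f i → ∑ i, weight (a i) < N → False := by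
  induction N with
  | zero => exact fun _ _ _ _ _ _ _ _ _ _ _ _ _ h => absurd h (Nat.not_lt_zero _)
  | succ N ih =>
  intro f s e t a hf hF hdet hμ he ht heF hrel hN
  have hCp0 : (C p : ℂ[X][X]) ≠ 0 := C_ne_zero.2 hp0
  have hfF : ∀ i, f i ∈ F := fun i => hF ▸ Submodule.subset_span (Set.mem_range_self i)
  have hpe : C p • e ∈ F := by
    rw [hrel]
    exact sum_mem fun i _ => F.smul_mem _ (hfF i)
  have hli := linearIndependent_of_famDet_ne_zero hdet
  have ha : ∀ i, HasParity (τ * t * s i) (a i) :=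
    hasParity_of_sum hf.parity hli (hrel ▸ ht.smul hpτ)
  have hmon : ∀ i, HasParity (τ * t * s i) (monomial (a i).natDegree (a i).leadingCoeff) :=
    fun i => (ha i).monomial_coeff _
  have hlc : ∀ i, HasParity ((-1) ^ (a i).natDegree * (τ * t * s i)) (C (a i).leadingCoeff) :=
    fun i => (ha i).C_coeff _
  have hsub : ∀ i y, HasParity (τ * t * s i) (C p * y) → VecParity t (e - y • f i) ∧
      e - y • f i ∈ E ∧ e - y • f i ∉ F := by
    intro i y hy
    have h1 := VecParity.smul (hpτ.of_mul_left hCp0 hy) (hf.parity i)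
    have h2 : ∀ a b c : ℤˣ, a * (a * b * c) * c = b := by decide
    rw [h2] at h1
    refine ⟨fun k => (ht k).sub (h1 k), sub_mem he (E.smul_mem _ (hf.mem i)), fun h => heF ?_⟩
    simpa using add_mem h (F.smul_mem y (hfF i))
  have hcop : ∀ c κ, HasParity κ (C c) → ¬ p ∣ c → IsCoprime c p := by
    intro c κ hc hpc
    have hce : C c • e ∉ F := fun h => hpc (hann e t ht he heF hpe c h)
    refine isCoprime_of_dvd c p (fun h => hp0 h.2) ?_
    rintro z hz - ⟨k, rfl⟩ ⟨h, hh⟩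
    have h1 : p ∣ h := by
      refine hann _ _ (ht.smul hc) (E.smul_mem _ he) hce ?_ h ?_
      · rw [smul_comm]
        exact F.smul_mem _ hpe
      · rw [smul_smul, ← C_mul, show h * (z * k) = k * p by rw [hh]; ring, C_mul, mul_smul]
        exact F.smul_mem _ hpe
    obtain ⟨w, rfl⟩ := h1
    refine hz (IsUnit.of_mul_eq_one w ?_)
    apply mul_left_cancel₀ hp0
    linear_combination - hh
  by_cases hdvd : ∃ i, a i ≠ 0 ∧ p ∣ (a i).leadingCoeff
  · obtain ⟨i, hi, y, hy⟩ := hdvd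
    have hy' : C p * monomial (a i).natDegree y = monomial (a i).natDegree (a i).leadingCoeff := by
      rw [C_mul_monomial, hy]
    obtain ⟨h1, h2, h3⟩ := hsub i _ (hy' ▸ hmon i)
    refine ih f s _ t _ hf hF hdet hμ h2 h1 h3 (relation_update hrel i
      (y := monomial (a i).natDegree y) (z := (a i).eraseLead) ?_) ?_
    · rw [hy', self_sub_monomial_natDegree_leadingCoeff]
    · exact (sum_weight_update_lt a (degree_eraseLead_lt hi)).trans_le (Nat.lt_succ_iff.1 hN)
  push Not at hdvd
  obtain ⟨i, hi⟩ : ∃ i, a i ≠ 0 := by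
    by_contra! h
    simp only [h, zero_smul, Finset.sum_const_zero] at hrel
    exact heF ((smul_eq_zero.1 hrel).resolve_left hCp0 ▸ F.zero_mem)
  by_cases hother : ∃ j, j ≠ i ∧ a j ≠ 0
  · obtain ⟨j, hji, hj⟩ := hother
    wlog hle : (a j).natDegree ≤ (a i).natDegree generalizing i j
    · exact this j hj i hji.symm hi (by omega)
    obtain ⟨x, w, hxw⟩ := hcop _ _ (hlc j) (hdvd j hj)
    obtain ⟨x, w, hx, hxw⟩ : ∃ x w, HasParity ((-1) ^ (a j).natDegree * (τ * t * s j)) (C x) ∧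
        x * (a j).leadingCoeff + w * p = 1 := by
      have h1 : (C x * C (a j).leadingCoeff + C w * C p : ℂ[X][X]) = 1 := by
        rw [← C_mul, ← C_mul, ← C_add, hxw, C_1]
      have h2 := congrArg (component 1) h1
      rw [map_add, (hlc j).component_mul, hpτ.component_mul, HasParity.one.component_eq, one_mul,
        component_C, component_C, ← C_mul, ← C_mul, ← C_add, ← C_1] at h2
      refine ⟨_, _, ?_, C_injective h2⟩
      rw [← component_C]
      exact hasParity_component _ _
    set q : ℂ[X][X] := monomial ((a i).natDegree - (a j).natDegree) ((a i).leadingCoeff * x) with hq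
    have hqX : q = X ^ ((a i).natDegree - (a j).natDegree) * (C (a i).leadingCoeff * C x) := by
      rw [hq, ← C_mul_X_pow_eq_monomial, C_mul, mul_comm]
    have hqpar : HasParity (s j * s i) q := by
      rw [hqX]
      convert (HasParity.X.pow _).mul ((hlc i).mul hx) using 1
      obtain ⟨d, hd⟩ := Nat.exists_eq_add_of_le hle
      rw [hd, Nat.add_sub_cancel_left, pow_add]
      generalize (-1 : ℤˣ) ^ d = u
      generalize (-1 : ℤˣ) ^ (a j).natDegree = v
      generalize τ * t = r
      generalize s i = y
      generalize s j = z
      revert u v r y z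
      decide
    have hfj : VecParity (s j) (f j + q • f i) := by
      have h1 := VecParity.smul hqpar (hf.parity i)
      rw [mul_assoc, Int.units_mul_self, mul_one] at h1
      exact fun k => (hf.parity j k).add (h1 k)
    have hf' := hf.update j (E.add_mem (hf.mem j) (E.smul_mem q (hf.mem i))) hfj
    have hqa : ∀ l, (a i).natDegree ≤ l → (q * a j).coeff l =
        (monomial (a i).natDegree ((a i).leadingCoeff * (1 - w * p))).coeff l := by
      intro l hl
      rw [hqX, show X ^ ((a i).natDegree - (a j).natDegree) * (C (a i).leadingCoeff * C x) * a j =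
        C ((a i).leadingCoeff * x) * a j * X ^ ((a i).natDegree - (a j).natDegree) by
          rw [C_mul]; ring, coeff_mul_X_pow', if_pos (by omega), coeff_C_mul, coeff_monomial]
      split_ifs with h
      · rw [← h, Nat.sub_sub_self hle, coeff_natDegree]
        linear_combination (a i).leadingCoeff * hxw
      · rw [coeff_eq_zero_of_natDegree_lt (by omega), mul_zero]
    have hy : HasParity (τ * t * s i)
        (C p * monomial (a i).natDegree ((a i).leadingCoeff * w)) := by
      have e1 : C p * monomial (a i).natDegree ((a i).leadingCoeff * w) =
          monomial (a i).natDegree (a i).leadingCoeff -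
          monomial (a i).natDegree (a i).leadingCoeff * (C x * C (a j).leadingCoeff) := by
        rw [← C_mul, C_mul_monomial, monomial_mul_C, ← map_sub]
        congr 1
        linear_combination (a i).leadingCoeff * hxw
      have h1 := (hmon i).mul (hx.mul (hlc j))
      rw [Int.units_mul_self, mul_one] at h1
      rw [e1]
      exact (hmon i).sub h1
    obtain ⟨h1, h2, h3⟩ := hsub i _ hy
    have hrel' := hrel.trans (relation_update_family hji.symm q)
    have hrel'' := relation_update (R := ℂ[X][X]) (M := Fin m → ℂ[X][X]) hrel' i
      (y := monomial (a i).natDegree ((a i).leadingCoeff * w)) rfl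
    rw [Function.update_self, Function.update_idem, Function.update_of_ne hji.symm] at hrel''
    refine ih _ _ _ t _ hf' ((span_update_add f hji.symm q).trans hF)
      ((famDet_update_add f hji.symm q).symm ▸ hdet)
      ((famDet_update_add f hji.symm q).symm ▸ hμ) h2 h1 h3 hrel'' ?_
    refine (sum_weight_update_lt a ?_).trans_le (Nat.lt_succ_iff.1 hN)
    rw [degree_eq_natDegree hi, degree_lt_iff_coeff_zero]
    intro l hl
    rw [coeff_sub, coeff_sub, hqa l hl, C_mul_monomial, coeff_monomial, coeff_monomial]
    split_ifs with h
    · rw [← h, coeff_natDegree]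
      ring
    · rw [coeff_eq_zero_of_natDegree_lt (by omega)]
      ring
  · push Not at hother
    rw [Finset.sum_eq_single i (fun j _ hj => by rw [hother j hj, zero_smul]) (by simp)] at hrel
    have hdvd' : ∀ k, C p ∣ f i k := fun k => by
      refine C_dvd_of_C_dvd_mul (hcop _ _ (hlc i) (hdvd i hi)) ((f i k).natDegree + 1) _ ?_
        ⟨e k, (congrFun hrel k).symm⟩
      exact lt_of_le_of_lt degree_le_natDegree (by exact_mod_cast Nat.lt_succ_self _)
    choose f' hf' using hdvd'
    have hfi : f i = C p • f' := _root_.funext hf'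
    have hf'E : f' ∈ E := hsat _ hCp0 _ (hfi ▸ hf.mem i)
    have hpar : VecParity (τ * s i) f' := fun k =>
      hpτ.of_mul_left hCp0 (hf' k ▸ hf.parity i k)
    have hD : C p * famDet g (Function.update f i f') = famDet g f := by
      have := famDet_update g f (b := C p) (r := Pi.single i 1) (e := f')
        (by simp [hfi, Pi.single_apply, ite_smul]) i
      simpa using this
    refine hmin _ _ (hf.update i hf'E hpar) (right_ne_zero_of_mul (hD ▸ hdet)) ?_
    exact hμ ▸ lexDegree_lt_of_C_mul_eq hD hdet hp1

end Minimal

lemma exists_component_C (s : ℤˣ) (d : ℂ[X]) :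
    ∃ d' : ℂ[X], component s (C d) = C d' ∧ d'.natDegree ≤ d.natDegree := by
  refine ⟨_, component_C s d, ?_⟩
  refine (natDegree_C_mul_le _ _).trans (natDegree_add_le_of_degree_le le_rfl ?_)
  rw [← C_eq_intCast]
  refine (natDegree_C_mul_le _ _).trans ?_
  simp [natDegree_comp]

/-- **Graded Seshadri theorem.** A graded saturated submodule of a free module over `ℂ[u,v]`, with
`u` and `v` odd, has a basis of homogeneous elements. -/
theorem exists_homogeneous_basis (E : Submodule ℂ[X][X] (Fin m → ℂ[X][X]))
    (hsat : ∀ b : ℂ[X][X], b ≠ 0 → ∀ w, b • w ∈ E → w ∈ E)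
    (hgr : ∀ s, ∀ w ∈ E, vecComponent s w ∈ E) :
    ∃ (n : ℕ) (f : Fin n → Fin m → ℂ[X][X]) (s : Fin n → ℤˣ), HomFamily E f s ∧
      LinearIndependent ℂ[X][X] f ∧ Submodule.span ℂ[X][X] (Set.range f) = E := by
  classical
  obtain ⟨n, ⟨f₀, s₀, hf₀, hli₀⟩, htors⟩ := exists_maximal_homFamily E
  obtain ⟨g, hg⟩ := exists_linearMap_det_ne_zero hli₀
  let S : Set (ℕ ×ₗ ℕ) := {μ | ∃ (f : Fin n → Fin m → ℂ[X][X]) (s : Fin n → ℤˣ),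
    HomFamily E f s ∧ famDet g f ≠ 0 ∧ lexDegree (famDet g f) = μ}
  obtain ⟨μ, ⟨f, s, hf, hdet, hμ⟩, hμmin⟩ :=
    (wellFounded_lt (α := ℕ ×ₗ ℕ)).has_min S ⟨_, f₀, s₀, hf₀, hg, rfl⟩
  have hmin : ∀ f s, HomFamily E f s → famDet g f ≠ 0 → ¬ lexDegree (famDet g f) < μ :=
    fun f s hf hd => hμmin _ ⟨f, s, hf, hd, rfl⟩
  have hli := linearIndependent_of_famDet_ne_zero hdet
  refine ⟨n, f, s, hf, hli, ?_⟩
  set F := Submodule.span ℂ[X][X] (Set.range f) with hF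
  have hhom : ∀ e t, VecParity t e → e ∈ E → e ∈ F := by
    by_contra! hcon
    obtain ⟨e, t, ht, he, heF⟩ := hcon
    have hex : ∃ d, ∃ (c : ℂ[X]) (e : Fin m → ℂ[X][X]) (t : ℤˣ), VecParity t e ∧ e ∈ E ∧ e ∉ F ∧
        c ≠ 0 ∧ C c • e ∈ F ∧ c.natDegree = d := by
      obtain ⟨b, hb, hbe⟩ := htors f s hf hli e he t ht
      obtain ⟨c, hc, hce⟩ := exists_C_smul_mem hmin hf hdet hμ he ht hb hbe
      exact ⟨_, c, e, t, ht, he, heF, hc, hce, rfl⟩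
    obtain ⟨c, e, t, ht, he, heF, hc, hce, hcd⟩ := Nat.find_spec hex
    obtain ⟨τ, hτ⟩ := component_ne_zero_or (C_ne_zero.2 hc)
    obtain ⟨p, hp, hpd⟩ := exists_component_C τ c
    have hp0 : p ≠ 0 := by
      rintro rfl
      exact hτ (by rw [hp, C_0])
    have hpe : C p • e ∈ F := by
      have h1 := vecComponent_mem_span (s := τ * t) hf.parity hce
      rwa [ht.vecComponent_smul, mul_assoc, Int.units_mul_self, mul_one, hp] at h1
    have hann : ∀ e t, VecParity t e → e ∈ E → e ∉ F → C p • e ∈ F →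
        ∀ d : ℂ[X], C d • e ∈ F → p ∣ d := by
      intro e t ht he heF hpe d hd
      by_contra hpd'
      have hr : d % p ≠ 0 := fun h => hpd' (EuclideanDomain.mod_eq_zero.1 h)
      have hre : C (d % p) • e ∈ F := by
        have h1 : C (d % p) • e = C d • e - C (d / p) • C p • e := by
          rw [smul_smul, ← C_mul, eq_sub_iff_add_eq, ← add_smul, ← C_add, mul_comm,
            EuclideanDomain.mod_add_div]
        rw [h1]
        exact F.sub_mem hd (F.smul_mem _ hpe)
      have h2 := Nat.find_min' hex ⟨_, e, t, ht, he, heF, hr, hre, rfl⟩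
      have h3 : (d % p).natDegree < p.natDegree :=
        natDegree_lt_natDegree hr (EuclideanDomain.mod_lt d hp0)
      omega
    have hp1 : p.natDegree ≠ 0 := by
      intro h0
      obtain ⟨z, rfl⟩ := natDegree_eq_zero.1 h0
      have h1 := F.smul_mem (C (C z⁻¹)) hpe
      rw [smul_smul, ← C_mul, ← C_mul, inv_mul_cancel₀ (C_ne_zero.1 hp0), C_1, C_1, one_smul] at h1
      exact heF h1
    obtain ⟨a, ha⟩ := (Submodule.mem_span_range_iff_exists_fun _).1 hpe
    exact no_relation hsat hmin hp0 hp1 (hp ▸ hasParity_component τ _) hann _ f s e t a hf rfl hdet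
      hμ he ht heF ha.symm (Nat.lt_succ_self _)
  refine le_antisymm (Submodule.span_le.2 (Set.range_subset_iff.2 hf.mem)) fun e he => ?_
  rw [← vecComponent_add_vecComponent_neg 1 e]
  exact F.add_mem (hhom _ _ (vecParity_vecComponent _ _) (hgr _ _ he))
    (hhom _ _ (vecParity_vecComponent _ _) (hgr _ _ he))

lemma HasParity.component_eq_zero {b : ℂ[X][X]} (hb : HasParity (-1) b) : component 1 b = 0 := by
  have h := component_add_component_neg 1 b
  rwa [hb.component_eq, add_eq_right] at h

/-- The homomorphism from the coordinate ring of the quadric cone to `ℂ[u][v]` given by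
`x ↦ u²`, `y ↦ v²`, `z ↦ uv`. -/
noncomputable def coneEmbedding : QuadricConeRing →+* ℂ[X][X] :=
  Ideal.Quotient.lift _
    (MvPolynomial.eval₂Hom ((C : ℂ[X] →+* ℂ[X][X]).comp C) ![C X ^ 2, X ^ 2, C X * X]) (by
      intro a ha
      rw [← RingHom.mem_ker]
      refine (Ideal.span_le (I := RingHom.ker _)).2 ?_ ha
      rw [Set.singleton_subset_iff, SetLike.mem_coe, RingHom.mem_ker]
      simp
      ring)

lemma coneEmbedding_mk (q : MvPolynomial (Fin 3) ℂ) :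
    coneEmbedding (Ideal.Quotient.mk _ q) =
      MvPolynomial.eval₂Hom ((C : ℂ[X] →+* ℂ[X][X]).comp C) ![C X ^ 2, X ^ 2, C X * X] q := rfl

lemma hasParity_coneEmbedding (a : QuadricConeRing) : HasParity 1 (coneEmbedding a) := by
  obtain ⟨q, rfl⟩ := Ideal.Quotient.mk_surjective a
  have h : negVars.comp (coneEmbedding.comp (Ideal.Quotient.mk _)) =
      coneEmbedding.comp (Ideal.Quotient.mk _) := by
    apply MvPolynomial.ringHom_ext
    · intro z
      simp [coneEmbedding_mk, negVars_C_C]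
    · intro i
      fin_cases i <;> simp [coneEmbedding_mk, negVars_C, negVars_X] <;> ring
  have h1 := DFunLike.congr_fun h q
  simpa [HasParity] using h1

lemma component_one_mem_range (b : ℂ[X][X]) : component 1 b ∈ coneEmbedding.range := by
  induction b using Polynomial.induction_on' with
  | add p q hp hq => rw [map_add]; exact add_mem hp hq
  | monomial k c =>
    induction c using Polynomial.induction_on' with
    | add p q hp hq => rw [map_add, map_add]; exact add_mem hp hq
    | monomial i z =>
      have hz : HasParity 1 (C (C z)) := by simp [HasParity, negVars_C_C]
      have hu : HasParity (-1) (C X) := by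
        rw [HasParity, negVars_C]
        simp
        ring
      have e1 : (monomial k (monomial i z) : ℂ[X][X]) = C (C z) * (C X ^ i * X ^ k) := by
        rw [← C_mul_X_pow_eq_monomial, ← C_mul_X_pow_eq_monomial, C_mul, C_pow, mul_assoc]
      have hpar : HasParity ((-1) ^ (i + k)) (monomial k (monomial i z)) := by
        rw [e1]
        simpa [pow_add] using hz.mul ((hu.pow i).mul (HasParity.X.pow k))
      rcases Nat.even_or_odd (i + k) with h | h
      · rw [h.neg_one_pow] at hpar
        rw [hpar.component_eq, e1]
        rcases Nat.even_or_odd' i with ⟨i', rfl | rfl⟩ <;>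
          rcases Nat.even_or_odd' k with ⟨k', rfl | rfl⟩
        · refine ⟨Ideal.Quotient.mk _ (MvPolynomial.C z * (MvPolynomial.X 0 ^ i' *
            MvPolynomial.X 1 ^ k')), ?_⟩
          simp [coneEmbedding_mk, pow_mul]
        · exact absurd h (by grind)
        · exact absurd h (by grind)
        · refine ⟨Ideal.Quotient.mk _ (MvPolynomial.C z * (MvPolynomial.X 0 ^ i' *
            MvPolynomial.X 1 ^ k' * MvPolynomial.X 2)), ?_⟩
          simp only [map_mul, map_pow, coneEmbedding_mk, MvPolynomial.coe_eval₂Hom,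
            MvPolynomial.eval₂_C, MvPolynomial.eval₂_X]
          simp [pow_mul, pow_succ]
          left
          ring
      · rw [h.neg_one_pow] at hpar
        rw [hpar.component_eq_zero]
        exact zero_mem _

lemma exists_coneEmbedding_eq {b : ℂ[X][X]} (hb : HasParity 1 b) :
    ∃ a, coneEmbedding a = b := by
  have h := component_one_mem_range b
  rwa [hb.component_eq] at h

/-- The homomorphism from `ℂ[x][y]` to the coordinate ring of the quadric cone. -/
noncomputable def polyToCone : ℂ[X][X] →+* QuadricConeRing :=
  eval₂RingHom (eval₂RingHom ((Ideal.Quotient.mk _).comp MvPolynomial.C)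
    (Ideal.Quotient.mk _ (MvPolynomial.X 0))) (Ideal.Quotient.mk _ (MvPolynomial.X 1))

lemma exists_eq_polyToCone_add (a : QuadricConeRing) :
    ∃ q r, a = polyToCone q + Ideal.Quotient.mk _ (MvPolynomial.X 2) * polyToCone r := by
  obtain ⟨a, rfl⟩ := Ideal.Quotient.mk_surjective a
  induction a using MvPolynomial.induction_on with
  | C z => exact ⟨C (C z), 0, by simp [polyToCone]⟩
  | add p q hp hq =>
    obtain ⟨p₁, p₂, hp⟩ := hp
    obtain ⟨q₁, q₂, hq⟩ := hq
    refine ⟨p₁ + q₁, p₂ + q₂, ?_⟩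
    rw [map_add, hp, hq, map_add, map_add]
    ring
  | mul_X p i hp =>
    obtain ⟨p₁, p₂, hp⟩ := hp
    have hx : polyToCone (C X) = Ideal.Quotient.mk _ (MvPolynomial.X 0) := by simp [polyToCone]
    have hy : polyToCone X = Ideal.Quotient.mk _ (MvPolynomial.X 1) := by simp [polyToCone]
    have hxy : (Ideal.Quotient.mk _ (MvPolynomial.X 0) * Ideal.Quotient.mk _ (MvPolynomial.X 1) :
        QuadricConeRing) = Ideal.Quotient.mk _ (MvPolynomial.X 2) ^ 2 := by
      rw [← map_mul, ← map_pow, Ideal.Quotient.eq]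
      exact Ideal.mem_span_singleton_self _
    rw [map_mul, hp]
    fin_cases i
    · refine ⟨p₁ * C X, p₂ * C X, ?_⟩
      rw [map_mul, map_mul, hx]
      simp only [Fin.zero_eta]
      ring
    · refine ⟨p₁ * X, p₂ * X, ?_⟩
      rw [map_mul, map_mul, hy]
      simp only [Fin.mk_one]
      ring
    · refine ⟨p₂ * (C X * X), p₁, ?_⟩
      rw [map_mul, map_mul, hx, hy, hxy]
      simp only [Fin.reduceFinMk]
      ring

lemma coneEmbedding_polyToCone (q : ℂ[X][X]) :
    coneEmbedding (polyToCone q) = expand ℂ[X] 2 (q.map (expand ℂ 2 : ℂ[X] →+* ℂ[X])) := by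
  have h : coneEmbedding.comp polyToCone = ((expand ℂ[X] 2 : ℂ[X][X] →+* ℂ[X][X])).comp
      (mapRingHom (expand ℂ 2 : ℂ[X] →+* ℂ[X])) := by
    ext <;> simp [polyToCone, coneEmbedding_mk]
  exact DFunLike.congr_fun h q

lemma coneEmbedding_injective : Function.Injective coneEmbedding := by
  rw [injective_iff_map_eq_zero]
  intro a ha
  obtain ⟨q, r, rfl⟩ := exists_eq_polyToCone_add a
  have hinj : ∀ q, coneEmbedding (polyToCone q) = 0 → q = 0 := by
    intro q hq
    rw [coneEmbedding_polyToCone] at hq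
    have h1 := (expand_eq_zero two_pos).1 hq
    exact (Polynomial.map_eq_zero_iff (expand_injective two_pos)).1 h1
  have hcomp : ∀ q, (coneEmbedding (polyToCone q)).comp (-X) = coneEmbedding (polyToCone q) := by
    intro q
    have hX : (-X : ℂ[X][X]) ^ 2 = X ^ 2 := by ring
    rw [coneEmbedding_polyToCone, expand_eq_comp_X_pow, comp_assoc, X_pow_comp, hX]
  have hz : coneEmbedding (Ideal.Quotient.mk _ (MvPolynomial.X 2)) = C X * X := by
    simp [coneEmbedding_mk]
  rw [map_add, map_mul, hz] at ha
  have h1 := congrArg (fun b => b.comp (-X)) ha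
  simp only [add_comp, mul_comp, hcomp, C_comp, X_comp, zero_comp] at h1
  have hq : q = 0 := by
    apply hinj
    linear_combination C (C 2⁻¹) * ha + C (C 2⁻¹) * h1 -
      coneEmbedding (polyToCone q) * half_mul_two
  have hr : r = 0 := by
    apply hinj
    rw [hq, map_zero, map_zero, zero_add] at ha
    exact (mul_eq_zero.1 ha).resolve_left (mul_ne_zero (C_ne_zero.2 X_ne_zero) X_ne_zero)
  rw [hq, hr, map_zero, mul_zero, add_zero]

lemma HasParity.eval_zero {b : ℂ[X][X]} (hb : HasParity (-1) b) : (b.eval 0).eval 0 = 0 := by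
  have h := hb.C_coeff 0
  rw [pow_zero, one_mul, HasParity, negVars_C] at h
  have h1 := congrArg (fun c => (c.coeff 0).eval 0) h
  rw [← coeff_zero_eq_eval_zero b]
  simp only [coeff_C_zero, eval_comp] at h1
  simp at h1
  linear_combination (1 / 2 : ℂ) * h1

/-- The family of images of a vector under `coneEmbedding`. -/
noncomputable def vecEmbedding (w : Fin m → QuadricConeRing) : Fin m → ℂ[X][X] :=
  fun k => coneEmbedding (w k)

lemma vecEmbedding_injective : Function.Injective (vecEmbedding (m := m)) :=
  fun _ _ h => _root_.funext fun k => coneEmbedding_injective (congrFun h k)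

lemma vecEmbedding_sum {ι : Type*} (S : Finset ι) (a : ι → QuadricConeRing)
    (w : ι → Fin m → QuadricConeRing) :
    vecEmbedding (∑ i ∈ S, a i • w i) = ∑ i ∈ S, coneEmbedding (a i) • vecEmbedding (w i) := by
  ext1 k
  simp [vecEmbedding, Finset.sum_apply]

lemma exists_vecEmbedding_eq {w : Fin m → ℂ[X][X]} (hw : VecParity 1 w) :
    ∃ v, vecEmbedding v = w := by
  choose v hv using fun k => exists_coneEmbedding_eq (hw k)
  exact ⟨v, _root_.funext hv⟩

/-- The image of an idempotent endomorphism of a free module over the coordinate ring of the cone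
becomes, over `ℂ[u][v]`, a free module with a basis of even vectors. -/
lemma exists_even_basis (e : (Fin m → QuadricConeRing) →ₗ[QuadricConeRing] Fin m → QuadricConeRing)
    (he : ∀ w, e (e w) = e w) :
    ∃ (n : ℕ) (f : Fin n → Fin m → QuadricConeRing), (∀ i, e (f i) = f i) ∧
      LinearIndependent ℂ[X][X] (fun i => vecEmbedding (f i)) ∧
      ∀ w, e w = w → vecEmbedding w ∈
        Submodule.span ℂ[X][X] (Set.range fun i => vecEmbedding (f i)) := by
  let col : Fin m → Fin m → ℂ[X][X] := fun j => vecEmbedding (e (Pi.single j 1))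
  let eB : (Fin m → ℂ[X][X]) →ₗ[ℂ[X][X]] Fin m → ℂ[X][X] := Fintype.linearCombination _ col
  have heB : ∀ w, eB w = ∑ j, w j • col j := fun w => Fintype.linearCombination_apply _ _ _
  have hcol : ∀ j, VecParity 1 (col j) := fun j k => hasParity_coneEmbedding _
  have heBv : ∀ w, eB (vecEmbedding w) = vecEmbedding (e w) := by
    intro w
    have h1 : e w = ∑ j, w j • e (Pi.single j 1) := by
      conv_lhs => rw [pi_eq_sum_univ' w, map_sum]
      simp only [map_smul]
    rw [heB, h1, vecEmbedding_sum]
    rfl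
  have hidem : ∀ w, eB (eB w) = eB w := by
    intro w
    rw [heB w, map_sum]
    refine Finset.sum_congr rfl fun j _ => ?_
    rw [map_smul, heBv, he]
  let E : Submodule ℂ[X][X] (Fin m → ℂ[X][X]) := LinearMap.eqLocus eB LinearMap.id
  have hE : ∀ w, w ∈ E ↔ eB w = w := fun w => Iff.rfl
  obtain ⟨n, f, s, hf, hli, hspan⟩ := exists_homogeneous_basis E
    (fun b hb w hw => by
      rw [hE, map_smul] at hw
      exact (hE w).2 (smul_right_injective _ hb hw))
    (fun s w hw => by
      rw [hE] at hw ⊢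
      conv_rhs => rw [← hw, heB, vecComponent_sum hcol]
      rw [heB, mul_one]
      rfl)
  have hs : ∀ i, s i = 1 := by
    intro i
    refine (Int.units_eq_one_or (s i)).resolve_right fun hsi => ?_
    have hcolE : ∀ j, col j ∈ Submodule.span ℂ[X][X] (Set.range f) := fun j => by
      rw [hspan, hE, heBv, he]
    choose c hc using fun j => (Submodule.mem_span_range_iff_exists_fun _).1 (hcolE j)
    have h1 : ∑ l, (∑ j, f i j * c j l) • f l = f i := by
      conv_rhs => rw [← (hE _).1 (hf.mem i), heB]
      simp only [← hc, Finset.smul_sum, Finset.sum_smul, smul_smul]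
      exact Finset.sum_comm
    have h2 : ∑ l, (∑ j, f i j * c j l - (Pi.single i 1 : Fin n → ℂ[X][X]) l) • f l = 0 := by
      refine (Finset.sum_congr rfl fun l _ =>
        sub_smul (∑ j, f i j * c j l) ((Pi.single i 1 : Fin n → ℂ[X][X]) l) (f l)).trans ?_
      rw [Finset.sum_sub_distrib, h1]
      simp [Pi.single_apply, ite_smul]
    have h3 := Fintype.linearIndependent_iff.1 hli _ h2 i
    have h4 := congrArg (fun b => (b.eval 0).eval 0) h3
    have h5 : ∀ j, ((f i j).eval 0).eval 0 = 0 := fun j => by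
      have := hf.parity i j
      rw [hsi] at this
      exact this.eval_zero
    simp [eval_finsetSum, h5] at h4
  choose v hv using fun i => exists_vecEmbedding_eq (hs i ▸ hf.parity i)
  have hv' : (fun i => vecEmbedding (v i)) = f := _root_.funext hv
  refine ⟨n, v, fun i => vecEmbedding_injective ?_, ?_, ?_⟩
  · rw [← heBv, hv]
    exact (hE _).1 (hf.mem i)
  · rwa [hv']
  · intro w hw
    rw [hv', hspan, hE, heBv, hw]

end Polynomial.Parity

open Polynomial.Parity in
/-- **Murthy–Pedrini.** Every finitely generated projective module over the
ring `ℂ[x,y,z]/(xy - z²)` is free.  In particular the affine quadric cone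
`Y = Spec ℂ[x,y,z]/(xy - z²)` has trivial Picard group (an invertible module is a rank-one
finitely generated projective module, hence free). -/
theorem quadricCone_finite_projective_free :
    ∀ (M : Type) [AddCommGroup M] [Module QuadricConeRing M],
      Module.Finite QuadricConeRing M → Module.Projective QuadricConeRing M →
        Module.Free QuadricConeRing M := by
  intro M _ _ _ _
  obtain ⟨m, p, i, -, hi, hpi⟩ := Module.Finite.exists_comp_eq_id_of_projective QuadricConeRing M
  have hpi' : ∀ x, p (i x) = x := fun x => LinearMap.congr_fun hpi x
  obtain ⟨n, f, hf, hli, hspan⟩ := exists_even_basis (i ∘ₗ p) (fun w => by simp [hpi'])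
  have hf' : ∀ j, i (p (f j)) = f j := hf
  have hliM : LinearIndependent QuadricConeRing fun j => p (f j) := by
    rw [Fintype.linearIndependent_iff]
    intro c hc j
    have h1 := congrArg (fun x => vecEmbedding (i x)) hc
    simp only [map_sum, map_smul, hf', vecEmbedding_sum, map_zero] at h1
    refine coneEmbedding_injective ?_
    rw [map_zero]
    refine Fintype.linearIndependent_iff.1 hli (fun j => coneEmbedding (c j)) (h1.trans ?_) j
    ext1 k
    simp [vecEmbedding]
  refine Module.Free.of_basis (Module.Basis.mk hliM fun x _ => ?_)
  obtain ⟨b, hb⟩ := (Submodule.mem_span_range_iff_exists_fun _).1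
    (hspan (i x) (by simp [hpi']))
  have hpar : ∀ j, HasParity 1 (b j) := fun j => by
    have hix : VecParity 1 (vecEmbedding (i x)) := fun k => hasParity_coneEmbedding _
    rw [← hb] at hix
    have h1 := hasParity_of_sum (s := 1) (σ := fun _ => 1)
      (fun _ _ => hasParity_coneEmbedding _) hli hix j
    simpa using h1
  choose c hc using fun j => exists_coneEmbedding_eq (hpar j)
  have hx : i x = ∑ j, c j • f j := by
    apply vecEmbedding_injective
    rw [vecEmbedding_sum, ← hb]
    simp only [hc]
  rw [← hpi' x, hx, map_sum]
  refine sum_mem fun j _ => ?_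
  rw [map_smul]
  exact Submodule.smul_mem _ _ (Submodule.subset_span (Set.mem_range_self j))
end

section
/- Let A be a Noetherian normal domain, and let f : X → Spec A be a finite unramified morphism from a scheme X such that every irreducible component of X dominates Spec A. Then f is étale (equivalently, flat). -/
universe u

open Polynomial in
/-- Over a normal domain `A`, let `S` be a local `A`-algebra receiving a map from a standard étale
algebra. If `S` maps to a torsion-free domain `L`, the kernel of the composite is killed by an
element that becomes a unit in `S`. -/
theorem StandardEtalePair.exists_isUnit_forall_mul_eq_zero
    {A S L : Type*} [CommRing A] [IsDomain A] [IsIntegrallyClosed A]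
    [CommRing S] [IsLocalRing S] [Algebra A S]
    [CommRing L] [IsDomain L] [Algebra A L] [Module.IsTorsionFree A L]
    (P : StandardEtalePair A) (ψ : P.Ring →ₐ[A] S) (χ : S →ₐ[A] L) :
    ∃ s : P.Ring, IsUnit (ψ s) ∧ ∀ c, χ (ψ c) = 0 → s * c = 0 := by
  have hx : aeval (χ (ψ P.X)) P.f = 0 := ((P.hasMap_X.map ψ).map χ).1
  have hint : IsIntegral A (χ (ψ P.X)) := ⟨P.f, P.monic_f, hx⟩
  obtain ⟨h, hh⟩ := minpoly.isIntegrallyClosed_dvd hint hx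
  refine ⟨aeval P.X h, ?_, fun c hc ↦ ?_⟩
  · have hu := (P.hasMap_X.map ψ).isUnit_derivative_f
    rw [hh, derivative_mul, map_add, map_mul, map_mul] at hu
    have hm : ¬ IsUnit (aeval (ψ P.X) (minpoly A (χ (ψ P.X)))) := fun hm ↦ by
      have := hm.map χ
      rw [← aeval_algHom_apply, minpoly.aeval] at this
      exact not_isUnit_zero this
    rw [← aeval_algHom_apply]
    rcases IsLocalRing.isUnit_or_isUnit_of_isUnit_add hu with hu | hu
    · exact isUnit_of_mul_isUnit_right hu
    · exact absurd (isUnit_of_mul_isUnit_left hu) hm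
  · let 𝓟 : StandardEtalePresentation A P.Ring := ⟨P, P.X, P.hasMap_X, by
      simpa [StandardEtalePair.lift_X_left] using Function.bijective_id⟩
    obtain ⟨r, n, hr⟩ := 𝓟.exists_mul_aeval_x_g_pow_eq_aeval_x c
    change c * aeval P.X P.g ^ n = aeval P.X r at hr
    have hr0 : aeval (χ (ψ P.X)) r = 0 := by
      rw [aeval_algHom_apply, aeval_algHom_apply, ← hr, map_mul, map_mul, hc, zero_mul]
    obtain ⟨k, rfl⟩ := minpoly.isIntegrallyClosed_dvd hint hr0
    have hf := P.hasMap_X.1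
    rw [hh, map_mul] at hf
    rw [map_mul] at hr
    refine (P.hasMap_X.2.pow n).mul_left_injective ?_
    dsimp only
    linear_combination aeval P.X h * hr + aeval P.X k * hf

/-- If a formally étale `A`-algebra `C` surjects onto a localization `Bf` of `B`, and the kernel is
killed by an element of `C` that becomes invertible in `B_Q`, then `B` is étale over `A` at `Q`. -/
theorem Algebra.IsEtaleAt.of_surjective_of_mul_eq_zero
    {A B C Bf : Type*} [CommRing A] [CommRing B] [Algebra A B] [CommRing C] [Algebra A C]
    [Algebra.FormallyEtale A C] [CommRing Bf] [Algebra B Bf] [Algebra A Bf]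
    (Q : Ideal B) [Q.IsPrime] [Algebra Bf (Localization.AtPrime Q)]
    [IsScalarTower A Bf (Localization.AtPrime Q)]
    [IsScalarTower B Bf (Localization.AtPrime Q)]
    (f : B) [IsLocalization.Away f Bf]
    (φ : C →ₐ[A] Bf) (hφ : Function.Surjective φ)
    (s : C) (hs : IsUnit (algebraMap Bf (Localization.AtPrime Q) (φ s)))
    (hker : ∀ c, φ c = 0 → s * c = 0) :
    Algebra.IsEtaleAt A Q := by
  let ψ : C →ₐ[A] Localization.AtPrime Q := (IsScalarTower.toAlgHom A Bf _).comp φ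
  algebraize [ψ.toRingHom]
  have : IsScalarTower A C (Localization.AtPrime Q) := .of_algebraMap_eq' ψ.comp_algebraMap.symm
  let M : Submonoid C := (IsUnit.submonoid (Localization.AtPrime Q)).comap ψ
  have hlift (b : B) : ∃ c, φ c = algebraMap B Bf b := hφ _
  have key (b : B) (c : C) (hc : φ c = algebraMap B Bf b) :
      algebraMap C (Localization.AtPrime Q) c = algebraMap B _ b := by
    rw [IsScalarTower.algebraMap_apply B Bf (Localization.AtPrime Q), ← hc]; rfl
  have : IsLocalization M (Localization.AtPrime Q) := by
    refine ⟨⟨fun y ↦ y.2, fun z ↦ ?_, fun {x y} hxy ↦ ?_⟩⟩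
    · obtain ⟨b, u, rfl⟩ := IsLocalization.exists_mk'_eq Q.primeCompl z
      obtain ⟨c, hc⟩ := hlift b
      obtain ⟨d, hd⟩ := hlift u
      refine ⟨(c, ⟨d, ?_⟩), ?_⟩
      · change IsUnit (algebraMap C (Localization.AtPrime Q) d)
        rw [key _ _ hd]
        exact IsLocalization.map_units _ u
      · dsimp only
        rw [key _ _ hc, key _ _ hd, IsLocalization.mk'_spec]
    · obtain ⟨⟨b, ⟨_, n, rfl⟩⟩, hb⟩ := IsLocalization.surj (Submonoid.powers f) (φ (x - y))
      have hb0 : algebraMap B (Localization.AtPrime Q) b = 0 := by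
        rw [IsScalarTower.algebraMap_apply B Bf (Localization.AtPrime Q), ← hb, map_mul]
        have : algebraMap Bf (Localization.AtPrime Q) (φ (x - y)) = 0 := by
          change algebraMap C (Localization.AtPrime Q) (x - y) = 0
          rw [map_sub, hxy, sub_self]
        rw [this, zero_mul]
      obtain ⟨v, hv⟩ := (IsLocalization.map_eq_zero_iff Q.primeCompl _ _).mp hb0
      obtain ⟨c, hc⟩ := hlift v
      have hzero : φ (c * (x - y)) = 0 := by
        have hfu : IsUnit (algebraMap B Bf (f ^ n)) :=
          IsLocalization.map_units Bf (⟨f ^ n, n, rfl⟩ : Submonoid.powers f)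
        refine hfu.mul_left_injective ?_
        dsimp only at hb ⊢
        rw [map_mul, mul_assoc, hb, hc, ← map_mul, hv, map_zero, zero_mul]
      refine ⟨⟨s * c, ?_⟩, ?_⟩
      · change IsUnit (ψ (s * c))
        rw [map_mul]
        refine hs.mul ?_
        change IsUnit (algebraMap C (Localization.AtPrime Q) c)
        rw [key _ _ hc]
        exact IsLocalization.map_units _ v
      · dsimp only
        linear_combination hker _ hzero
  have : Algebra.FormallyEtale C (Localization.AtPrime Q) := .of_isLocalization M
  exact Algebra.FormallyEtale.comp A C _

/-- Let `A` be a Noetherian normal (integrally closed) domain, and let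
`f : X → Spec A` be a finite unramified morphism from a scheme `X` such that every
irreducible component of `X` dominates `Spec A`.  Then `f` is étale (equivalently, flat).

Affine-locally: `B` is a finite unramified `A`-algebra such that every minimal prime of `B`
contracts to the zero ideal of `A` (components dominate the base); the conclusion is that
`B` is flat, hence étale, over `A`. -/
theorem finite_unramified_dominating_over_normal_is_etale
    (A B : Type u) [CommRing A] [IsDomain A] [IsIntegrallyClosed A] [IsNoetherianRing A]
    [CommRing B] [Algebra A B]
    [Module.Finite A B] [Algebra.Unramified A B]
    (hdom : ∀ p ∈ minimalPrimes B, Ideal.comap (algebraMap A B) p = ⊥) :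
    Module.Flat A B ∧ Algebra.Etale A B := by
  suffices Algebra.Etale A B from ⟨inferInstance, this⟩
  have : Algebra.FinitePresentation A B :=
    Algebra.FinitePresentation.of_finiteType.mp inferInstance
  refine Algebra.etaleLocus_eq_univ_iff_etale.mp (Set.eq_univ_of_forall fun ⟨Q, hQ⟩ ↦ ?_)
  change Algebra.IsEtaleAt A Q
  obtain ⟨p, hp, hpQ⟩ := Ideal.exists_minimalPrimes_le (I := (⊥ : Ideal B)) (J := Q) bot_le
  have hpp : p.IsPrime := hp.1.1
  have hbot := hdom p hp
  obtain ⟨f, hfQ, P, φ, hφ⟩ :=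
    Algebra.IsUnramifiedAt.exists_hasStandardEtaleSurjectionOn (R := A) Q
  let η : Localization.Away f →ₐ[B] Localization.AtPrime Q :=
    IsLocalization.liftAlgHom (M := .powers f) (f := Algebra.ofId B _) (by
      rintro ⟨_, n, rfl⟩
      exact IsLocalization.map_units _ (⟨f ^ n, Q.primeCompl.pow_mem hfQ n⟩ : Q.primeCompl))
  algebraize [η.toRingHom]
  have : IsScalarTower B (Localization.Away f) (Localization.AtPrime Q) :=
    .of_algebraMap_eq' η.comp_algebraMap.symm
  have : IsScalarTower A (Localization.Away f) (Localization.AtPrime Q) :=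
    .to₁₃₄ A B _ _
  let χ : Localization.AtPrime Q →ₐ[B] p.ResidueField :=
    IsLocalization.liftAlgHom (M := Q.primeCompl) (f := Algebra.ofId B _) (by
      rintro ⟨b, hb⟩
      simpa [isUnit_iff_ne_zero, Algebra.ofId_apply] using fun h ↦ hb (hpQ h))
  have : Module.IsTorsionFree A p.ResidueField := by
    rw [Module.isTorsionFree_iff_algebraMap_injective]
    rw [injective_iff_map_eq_zero]
    intro a ha
    rw [IsScalarTower.algebraMap_apply A B, Ideal.algebraMap_residueField_eq_zero] at ha
    exact (hbot.le ha :)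
  obtain ⟨s, hs, hker⟩ := P.exists_isUnit_forall_mul_eq_zero
    ((IsScalarTower.toAlgHom A _ (Localization.AtPrime Q)).comp φ) (χ.restrictScalars A)
  exact .of_surjective_of_mul_eq_zero Q f φ hφ s hs fun c hc ↦ hker c (by simp [hc])
end
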